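/- Fix N ≥ 2 and work on the N-qubit Hilbert space ℂ^(2^N). Let W = (1/√N) Σ_{j=1}^N |e_j⟩ be the generalized W state, let L_j (j = 1,…,N) be the local damping operators acting as |0⟩⟨1| on qubit j and identity elsewhere with dissipator D, and let ζ̂ = (1/N) Σ_j ζ_j ζ_j† with ζ_j = (1/√(N−1)) Σ_{k≠j} |e_{jk}⟩. Assume that (2/N)·Id − ζ̂ is positive semidefinite (i.e., every eigenvalue of ζ̂ is at most 2/N). Suppose ρ = p·WW† + (1−p)·σ where p ∈ [0,1] and σ is a density matrix with σW = 0. If ⟨W, D(ρ)W⟩ = 0, then p ≤ (2N−2)/(3N−2). -/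

import Mathlib

open Matrix
open scoped ComplexOrder

theorem lowering_conjTranspose_mulVec_single {N : ℕ}
    {L : Fin N → Matrix (Fin N → Fin 2) (Fin N → Fin 2) ℂ}
    (hL : ∀ j s t, L j s t = if t j = 1 ∧ s = Function.update t j 0 then 1 else 0)
    (j k : Fin N) :
    (L j)ᴴ *ᵥ Pi.single (Function.update (fun _ => 0) k 1) 1 =
      if k ≠ j then Pi.single (Function.update (Function.update (fun _ => 0) j 1) k 1) 1
      else 0 := by
  rw [mulVec_single_one]
  ext s
  simp only [col_apply, conjTranspose_apply, hL, apply_ite star, star_one, star_zero]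
  by_cases h : k = j
  · subst h
    have : ¬ (s k = 1 ∧ Function.update (fun _ => (0 : Fin 2)) k 1 = Function.update s k 0) := by
      rintro ⟨-, h⟩
      simpa using congrFun h k
    simp [this]
  · have : (s j = 1 ∧ Function.update (fun _ => (0 : Fin 2)) k 1 = Function.update s j 0) ↔
        s = Function.update (Function.update (fun _ => 0) j 1) k 1 := by
      rw [Function.update_comm (Ne.symm h), Function.eq_update_iff (a := j)
        (f := Function.update (fun _ => (0 : Fin 2)) k 1), Function.eq_update_iff]
      simp only [Function.update_of_ne (Ne.symm h), true_and, eq_comm]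
    simp [h, this, Pi.single_apply]

theorem lowering_mulVec_single {N : ℕ}
    {L : Fin N → Matrix (Fin N → Fin 2) (Fin N → Fin 2) ℂ}
    (hL : ∀ j s t, L j s t = if t j = 1 ∧ s = Function.update t j 0 then 1 else 0)
    (j k : Fin N) :
    L j *ᵥ Pi.single (Function.update (fun _ => 0) k 1) 1 =
      if j = k then Pi.single 0 1 else 0 := by
  rw [mulVec_single_one]
  ext s
  simp only [col_apply, hL]
  by_cases h : j = k
  · subst h
    simp [Pi.single_apply, funext_iff]
  · simp [h]

theorem lowering_conjTranspose_mulVec_vacuum {N : ℕ}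
    {L : Fin N → Matrix (Fin N → Fin 2) (Fin N → Fin 2) ℂ}
    (hL : ∀ j s t, L j s t = if t j = 1 ∧ s = Function.update t j 0 then 1 else 0)
    (j : Fin N) :
    (L j)ᴴ *ᵥ Pi.single 0 1 = Pi.single (Function.update (fun _ => 0) j 1) 1 := by
  rw [mulVec_single_one]
  ext s
  have : (s j = 1 ∧ (0 : Fin N → Fin 2) = Function.update s j 0) ↔
      s = Function.update (fun _ => 0) j 1 := by
    rw [Function.eq_update_iff, Function.eq_update_iff]
    simp [eq_comm]
  simp [hL, this, Pi.single_apply, apply_ite]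

theorem number_mulVec_single {N : ℕ}
    {L : Fin N → Matrix (Fin N → Fin 2) (Fin N → Fin 2) ℂ}
    (hL : ∀ j s t, L j s t = if t j = 1 ∧ s = Function.update t j 0 then 1 else 0)
    (j k : Fin N) :
    ((L j)ᴴ * L j) *ᵥ Pi.single (Function.update (fun _ => 0) k 1) 1 =
      if j = k then Pi.single (Function.update (fun _ => 0) k 1) 1 else 0 := by
  rw [← mulVec_mulVec, lowering_mulVec_single hL]
  split_ifs with h
  · rw [lowering_conjTranspose_mulVec_vacuum hL, h]
  · exact mulVec_zero _

theorem update_one_injective {N : ℕ} :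
    Function.Injective fun j : Fin N => Function.update (fun _ => (0 : Fin 2)) j 1 := by
  intro j k h
  simpa [Function.update_apply] using congrFun h j

theorem update_one_ne_update_update_one {N : ℕ} {j k : Fin N} (l : Fin N) (h : k ≠ j) :
    Function.update (fun _ => (0 : Fin 2)) l 1 ≠
      Function.update (Function.update (fun _ => 0) j 1) k 1 := by
  intro h3
  have hj := congrFun h3 j
  have hk := congrFun h3 k
  simp [Function.update_apply, h.symm] at hj hk
  exact h (hk.trans hj.symm)

open scoped MatrixOrder in
/-- Two positive semidefinite matrices have nonnegative Hilbert-Schmidt inner product. -/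
theorem Matrix.PosSemidef.trace_mul_nonneg {n : Type*} [Fintype n] [DecidableEq n]
    {A B : Matrix n n ℂ} (hA : A.PosSemidef) (hB : B.PosSemidef) : 0 ≤ (A * B).trace := by
  obtain ⟨C, rfl⟩ := CStarAlgebra.nonneg_iff_eq_star_mul_self.mp hB.nonneg
  rw [star_eq_conjTranspose, ← Matrix.mul_assoc, trace_mul_comm, ← Matrix.mul_assoc]
  exact (hA.mul_mul_conjTranspose_same C).trace_nonneg

theorem star_dotProduct_lindblad_mulVec {n : Type*} [Fintype n]
    (A M : Matrix n n ℂ) (w : n → ℂ) :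
    star w ⬝ᵥ ((A * M * Aᴴ - (1/2 : ℂ) • (Aᴴ * A * M + M * (Aᴴ * A))) *ᵥ w) =
      star (Aᴴ *ᵥ w) ⬝ᵥ (M *ᵥ (Aᴴ *ᵥ w)) - (1/2 : ℂ) *
        (star ((Aᴴ * A) *ᵥ w) ⬝ᵥ (M *ᵥ w) + star w ⬝ᵥ (M *ᵥ ((Aᴴ * A) *ᵥ w))) := by
  simp only [sub_mulVec, smul_mulVec, add_mulVec, dotProduct_sub, dotProduct_smul, dotProduct_add,
    star_mulVec, ← dotProduct_mulVec, mulVec_mulVec, conjTranspose_conjTranspose,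
    conjTranspose_mul, Matrix.mul_assoc, smul_eq_mul]

theorem stmt_11 {N : ℕ} (hN : 2 ≤ N)
    (e : Fin N → ((Fin N → Fin 2) → ℂ))
    (he : ∀ j, e j = fun s =>
      if s = Function.update (fun _ => 0) j 1 then 1 else 0)
    (W : (Fin N → Fin 2) → ℂ)
    (hW : W = ((Real.sqrt (N : ℝ))⁻¹ : ℂ) • ∑ j, e j)
    (L : Fin N → Matrix (Fin N → Fin 2) (Fin N → Fin 2) ℂ)
    (hL : ∀ j, L j = fun s t =>
      if t j = 1 ∧ s = Function.update t j 0 then 1 else 0)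
    (D : Matrix (Fin N → Fin 2) (Fin N → Fin 2) ℂ →
      Matrix (Fin N → Fin 2) (Fin N → Fin 2) ℂ)
    (hD : ∀ M, D M = ∑ j, (L j * M * (L j)ᴴ
      - (1/2 : ℂ) • ((L j)ᴴ * L j * M + M * ((L j)ᴴ * L j))))
    (e2 : Fin N → Fin N → ((Fin N → Fin 2) → ℂ))
    (he2 : ∀ j k, e2 j k = fun s =>
      if s = Function.update (Function.update (fun _ => 0) j 1) k 1 then 1 else 0)
    (ζ : Fin N → ((Fin N → Fin 2) → ℂ))
    (hζ : ∀ j, ζ j = ((Real.sqrt ((N : ℝ) - 1))⁻¹ : ℂ) •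
      ∑ k ∈ Finset.univ.filter (fun k => k ≠ j), e2 j k)
    (ζhat : Matrix (Fin N → Fin 2) (Fin N → Fin 2) ℂ)
    (hζhat : ζhat = ((N : ℂ))⁻¹ • ∑ j, Matrix.vecMulVec (ζ j) (star (ζ j)))
    (hbound : (((2 : ℂ) / (N : ℂ)) • (1 : Matrix (Fin N → Fin 2) (Fin N → Fin 2) ℂ)
      - ζhat).PosSemidef)
    (p : ℝ) (hp0 : 0 ≤ p) (hp1 : p ≤ 1)
    (σ : Matrix (Fin N → Fin 2) (Fin N → Fin 2) ℂ)
    (hσPSD : σ.PosSemidef) (hσTr : σ.trace = 1) (hσW : σ *ᵥ W = 0)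
    (ρ : Matrix (Fin N → Fin 2) (Fin N → Fin 2) ℂ)
    (hρ : ρ = (p : ℂ) • Matrix.vecMulVec W (star W) + ((1 : ℂ) - (p : ℂ)) • σ)
    (hstab : star W ⬝ᵥ (D ρ *ᵥ W) = 0) :
    p ≤ (2 * (N : ℝ) - 2) / (3 * (N : ℝ) - 2) := by
  have hN0 : (N : ℝ) ≠ 0 := by positivity
  have hN1 : (0 : ℝ) < (N : ℝ) - 1 := by
    have : (2 : ℝ) ≤ N := by exact_mod_cast hN
    linarith
  have hLa : ∀ j s t, L j s t = if t j = 1 ∧ s = Function.update t j 0 then 1 else 0 :=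
    fun j s t => by rw [hL]
  have hes : ∀ j, e j = Pi.single (Function.update (fun _ => 0) j 1) 1 := fun j => by
    ext s; simp [he, Pi.single_apply]
  have he2s : ∀ j k, e2 j k =
      Pi.single (Function.update (Function.update (fun _ => 0) j 1) k 1) 1 := fun j k => by
    ext s; simp [he2, Pi.single_apply]
  set c : ℂ := ((Real.sqrt (N : ℝ))⁻¹ : ℂ) with hc
  set d : ℂ := ((Real.sqrt ((N : ℝ) - 1))⁻¹ : ℂ) with hd
  have hcc : star c * c = (N : ℂ)⁻¹ := by
    rw [hc, star_inv₀, ← mul_inv, Complex.star_def, Complex.conj_ofReal, ← Complex.ofReal_mul,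
      Real.mul_self_sqrt (by positivity), Complex.ofReal_natCast]
  have hdd : star d * d = ((N : ℂ) - 1)⁻¹ := by
    rw [hd, star_inv₀, ← mul_inv, Complex.star_def, Complex.conj_ofReal, ← Complex.ofReal_mul,
      Real.mul_self_sqrt hN1.le]
    push_cast; rfl
  set u : Fin N → ((Fin N → Fin 2) → ℂ) :=
    fun j => ∑ k ∈ Finset.univ.filter (fun k => k ≠ j), e2 j k with hu
  have hLW : ∀ j, (L j)ᴴ *ᵥ W = c • u j := fun j => by
    rw [hW, mulVec_smul, mulVec_sum]
    congr 1
    change _ = ∑ k ∈ Finset.univ.filter (fun k => k ≠ j), e2 j k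
    rw [Finset.sum_filter]
    exact Finset.sum_congr rfl fun k _ => by
      rw [hes, lowering_conjTranspose_mulVec_single hLa, he2s]
  have hnum : ∑ j, ((L j)ᴴ * L j) *ᵥ W = W := by
    simp only [hW, mulVec_smul, mulVec_sum, ← Finset.smul_sum, hes, number_mulVec_single hLa]
    rw [Finset.sum_comm]
    simp
  have hWW : star W ⬝ᵥ W = 1 := by
    have : star (∑ j, e j) ⬝ᵥ (∑ j, e j) = N := by
      simp [hes, star_sum, dotProduct_sum, Pi.single_apply,
        update_one_injective.eq_iff]
    rw [hW, star_smul, smul_dotProduct, dotProduct_smul, this, smul_eq_mul, smul_eq_mul,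
      ← mul_assoc, hcc]
    exact inv_mul_cancel₀ (by exact_mod_cast hN0)
  have hWu : ∀ j, star W ⬝ᵥ u j = 0 := fun j => by
    rw [hW, hu, star_smul, smul_dotProduct, star_sum, sum_dotProduct]
    refine smul_eq_zero_of_right _ (Finset.sum_eq_zero fun l _ => ?_)
    rw [dotProduct_sum]
    refine Finset.sum_eq_zero fun k hk => ?_
    rw [hes, he2s, ← Pi.single_star, star_one, single_one_dotProduct, Pi.single_apply,
      if_neg (update_one_ne_update_update_one l (Finset.mem_filter.1 hk).2)]
  have hρW : ρ *ᵥ W = (p : ℂ) • W := by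
    rw [hρ, add_mulVec, smul_mulVec, smul_mulVec, vecMulVec_mulVec, hWW, hσW]
    simp
  have hWρ : star W ᵥ* ρ = (p : ℂ) • star W := by
    have hWσ : star W ᵥ* σ = 0 := by
      rw [← hσPSD.isHermitian.eq, ← star_mulVec, hσW, star_zero]
    rw [hρ, vecMul_add, vecMul_smul, vecMul_smul, vecMul_vecMulVec, hWW, hWσ]
    simp
  have hρu : ∀ j, ρ *ᵥ u j = ((1 : ℂ) - p) • (σ *ᵥ u j) := fun j => by
    rw [hρ, add_mulVec, smul_mulVec, smul_mulVec, vecMulVec_mulVec, hWu]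
    simp
  set Q : ℂ := ∑ j, star (u j) ⬝ᵥ (σ *ᵥ u j) with hQ
  have hbal : (N : ℂ)⁻¹ * (1 - p) * Q - p = 0 := by
    have h1 : ∑ j, star ((L j)ᴴ *ᵥ W) ⬝ᵥ (ρ *ᵥ ((L j)ᴴ *ᵥ W)) = (N : ℂ)⁻¹ * (1 - p) * Q := by
      rw [hQ, Finset.mul_sum]
      refine Finset.sum_congr rfl fun j _ => ?_
      rw [hLW, mulVec_smul, hρu, star_smul, smul_dotProduct, dotProduct_smul, dotProduct_smul,
        ← hcc]
      simp only [smul_eq_mul]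
      ring
    have h2 : ∑ j, star (((L j)ᴴ * L j) *ᵥ W) ⬝ᵥ (ρ *ᵥ W) = p := by
      rw [← sum_dotProduct, ← star_sum, hnum, hρW, dotProduct_smul, hWW, smul_eq_mul, mul_one]
    have h3 : ∑ j, star W ⬝ᵥ (ρ *ᵥ (((L j)ᴴ * L j) *ᵥ W)) = p := by
      rw [← dotProduct_sum, ← mulVec_sum, hnum, hρW, dotProduct_smul, hWW, smul_eq_mul, mul_one]
    rw [← hstab, hD, sum_mulVec, dotProduct_sum]
    simp only [star_dotProduct_lindblad_mulVec]
    rw [Finset.sum_sub_distrib, ← Finset.mul_sum, Finset.sum_add_distrib, h1, h2, h3]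
    ring
  have htr : (ζhat * σ).trace = (N : ℂ)⁻¹ * ((N : ℂ) - 1)⁻¹ * Q := by
    rw [hζhat, trace_mul_comm, mul_smul_comm, trace_smul, Matrix.mul_sum, trace_sum, hQ,
      smul_eq_mul, mul_assoc]
    congr 1
    rw [Finset.mul_sum]
    refine Finset.sum_congr rfl fun j _ => ?_
    rw [mul_vecMulVec, trace_vecMulVec, hζ, dotProduct_comm, star_smul, mulVec_smul,
      smul_dotProduct, dotProduct_smul, ← hdd, smul_eq_mul, smul_eq_mul, mul_assoc]
  have hQle : 0 ≤ (2 : ℂ) / N - (N : ℂ)⁻¹ * ((N : ℂ) - 1)⁻¹ * Q := by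
    have := hbound.trace_mul_nonneg hσPSD
    rwa [sub_mul, smul_mul_assoc, one_mul, trace_sub, trace_smul, hσTr, htr, smul_eq_mul,
      mul_one] at this
  have hre : (N : ℝ)⁻¹ * (1 - p) * Q.re - p = 0 := by
    have := congrArg Complex.re hbal
    rw [show (N : ℂ)⁻¹ * (1 - p) * Q = (((N : ℝ)⁻¹ * (1 - p) : ℝ) : ℂ) * Q by
      push_cast; rfl] at this
    simpa [Complex.re_ofReal_mul] using this
  have hle : 0 ≤ 2 / (N : ℝ) - (N : ℝ)⁻¹ * ((N : ℝ) - 1)⁻¹ * Q.re := by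
    have := (Complex.le_def.1 hQle).1
    rw [show (2 : ℂ) / N - (N : ℂ)⁻¹ * ((N : ℂ) - 1)⁻¹ * Q = ((2 / (N : ℝ) : ℝ) : ℂ) -
      (((N : ℝ)⁻¹ * ((N : ℝ) - 1)⁻¹ : ℝ) : ℂ) * Q by push_cast; rfl] at this
    rwa [Complex.sub_re, Complex.re_ofReal_mul, Complex.ofReal_re, Complex.zero_re] at this
  have hNpos : (0 : ℝ) < N := by linarith
  have hQ2 : Q.re ≤ 2 * ((N : ℝ) - 1) := by
    have h := mul_nonneg (mul_pos hNpos hN1).le hle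
    field_simp at h
    linarith
  have hp : (1 - p) * Q.re = p * N := by
    field_simp at hre
    linarith
  rw [le_div_iff₀ (by linarith)]
  nlinarith [mul_le_mul_of_nonneg_left hQ2 (sub_nonneg.2 hp1)]
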